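/- arXiv:1207.3161 — 2 statements merged into one kernel-verified Lean document; each statement's English description precedes it below -/
import Mathlib

section
/- Let f : ℂⁿ → ℂ be a mixed polynomial and z ∈ ℂⁿ with f(z) ≠ 0. If the vectors v₁(z) and v₂(z) are linearly dependent over ℝ, then z ∈ Sing f. -/
open Complex Finset Filter Topology

/-- Coefficients of a mixed polynomial in `n` variables: a finitely supported
function assigning to each pair of multi-indices `(ν, μ)` the coefficient `c_{ν,μ}`. -/
abbrev MixedCoeff (n : ℕ) := ((Fin n → ℕ) × (Fin n → ℕ)) →₀ ℂ

/-- Evaluation of the mixed polynomial `f(z, z̄) = Σ c_{ν,μ} z^ν z̄^μ`. -/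
noncomputable def mixedEval {n : ℕ} (c : MixedCoeff n) (z : Fin n → ℂ) : ℂ :=
  c.sum fun p a => a * (∏ j, z j ^ p.1 j) * ∏ j, (starRingEnd ℂ) (z j) ^ p.2 j

/-- Wirtinger derivative `∂f/∂z_j`. -/
noncomputable def wdz {n : ℕ} (c : MixedCoeff n) (j : Fin n) (z : Fin n → ℂ) : ℂ :=
  c.sum fun p a => a * (p.1 j : ℂ) * z j ^ (p.1 j - 1) *
    (∏ k ∈ Finset.univ.erase j, z k ^ p.1 k) * ∏ k, (starRingEnd ℂ) (z k) ^ p.2 k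

/-- Wirtinger derivative `∂f/∂z̄_j`. -/
noncomputable def wdzbar {n : ℕ} (c : MixedCoeff n) (j : Fin n) (z : Fin n → ℂ) : ℂ :=
  c.sum fun p a => a * (p.2 j : ℂ) * (starRingEnd ℂ) (z j) ^ (p.2 j - 1) *
    (∏ k ∈ Finset.univ.erase j, (starRingEnd ℂ) (z k) ^ p.2 k) * ∏ k, z k ^ p.1 k

/-- The point `ν + μ ∈ ℝⁿ` associated to a monomial `z^ν z̄^μ`. -/
def exptPt {n : ℕ} (p : (Fin n → ℕ) × (Fin n → ℕ)) : Fin n → ℝ := fun j => (p.1 j + p.2 j : ℕ)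

/-- `supp(f) ⊆ ℝⁿ`. -/
def mixedSupp {n : ℕ} (c : MixedCoeff n) : Set (Fin n → ℝ) :=
  {x | ∃ p ∈ c.support, exptPt p = x}

/-- The Newton polyhedron `Γ₀(f)`: convex hull of `{0} ∪ supp(f)`. -/
noncomputable def Gamma0 {n : ℕ} (c : MixedCoeff n) : Set (Fin n → ℝ) :=
  convexHull ℝ (insert 0 (mixedSupp c))

/-- `supp̄(f)`: convex hull of `supp(f) \ {0}`. -/
noncomputable def suppBar {n : ℕ} (c : MixedCoeff n) : Set (Fin n → ℝ) :=
  convexHull ℝ (mixedSupp c \ {0})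

/-- A face (of any dimension) of the Newton boundary at infinity `Γ⁺(f)`:
a face of `Γ₀(f)` not containing the origin. -/
def IsFaceAtInfinity {n : ℕ} (c : MixedCoeff n) (Δ : Set (Fin n → ℝ)) : Prop :=
  IsExtreme ℝ (Gamma0 c) Δ ∧ (0 : Fin n → ℝ) ∉ Δ

open Classical in
/-- The restriction `f_Δ` of `f` to a face `Δ`: keep the monomials with `ν + μ ∈ Δ`. -/
noncomputable def faceRestrict {n : ℕ} (c : MixedCoeff n) (Δ : Set (Fin n → ℝ)) :
    MixedCoeff n :=
  c.filter fun p => exptPt p ∈ Δ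

/-- `Sing f`: the set of mixed singularities, via Oka's characterization:
`conj (df) = λ · d̄f` for some `λ` with `|λ| = 1`. -/
def mixedSing {n : ℕ} (c : MixedCoeff n) : Set (Fin n → ℂ) :=
  {z | ∃ lam : ℂ, ‖lam‖ = 1 ∧
      ∀ j, (starRingEnd ℂ) (wdz c j z) = lam * wdzbar c j z}

/-- `(ℂ*)ⁿ`. -/
def cstarn (n : ℕ) : Set (Fin n → ℂ) := {z | ∀ j, z j ≠ 0}

/-- `f` is Newton strongly non-degenerate: `Sing f_Δ ∩ (ℂ*)ⁿ = ∅` for every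
face `Δ` of `Γ⁺(f)`. -/
def StronglyNonDeg {n : ℕ} (c : MixedCoeff n) : Prop :=
  ∀ Δ : Set (Fin n → ℝ), IsFaceAtInfinity c Δ →
    mixedSing (faceRestrict c Δ) ∩ cstarn n = ∅

/-- `f` is convenient: `supp(f)` meets every coordinate axis. -/
def Convenient {n : ℕ} (c : MixedCoeff n) : Prop :=
  ∀ j : Fin n, ∃ p ∈ c.support, 0 < p.1 j + p.2 j ∧ ∀ k, k ≠ j → p.1 k + p.2 k = 0

/-- `V(f) = f⁻¹(0)`. -/
def Vf {n : ℕ} (c : MixedCoeff n) : Set (Fin n → ℂ) := {z | mixedEval c z = 0}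

/-- `φ = f / |f|` (with junk value `0` on `V(f)`). -/
noncomputable def phiMap {n : ℕ} (c : MixedCoeff n) (z : Fin n → ℂ) : ℂ :=
  mixedEval c z / (‖mixedEval c z‖ : ℝ)

/-- `Sing φ = {z ∉ V(f) : conj(f)·d̄f = f·conj(df)}`. -/
def SingPhi {n : ℕ} (c : MixedCoeff n) : Set (Fin n → ℂ) :=
  {z | mixedEval c z ≠ 0 ∧
    ∀ j, (starRingEnd ℂ) (mixedEval c z) * wdzbar c j z
        = mixedEval c z * (starRingEnd ℂ) (wdz c j z)}

/-- The ρ-non-regular locus `M(φ)`. -/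
def Mphi {n : ℕ} (c : MixedCoeff n) : Set (Fin n → ℂ) :=
  {z | mixedEval c z ≠ 0 ∧ ∃ lam : ℝ, ∀ j,
    (lam : ℂ) * z j = Complex.I * (starRingEnd ℂ) (mixedEval c z) * wdzbar c j z
      - Complex.I * mixedEval c z * (starRingEnd ℂ) (wdz c j z)}

/-- The Milnor set `M(f)`. -/
def Mf {n : ℕ} (c : MixedCoeff n) : Set (Fin n → ℂ) :=
  {z | ∃ lam : ℝ, ∃ mu : ℂ, mu ≠ 0 ∧ ∀ j,
    (lam : ℂ) * z j = mu * (starRingEnd ℂ) (wdz c j z) + (starRingEnd ℂ) mu * wdzbar c j z}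

/-- The asymptotic ρ-non-regular values `S(φ)` of `f/|f|`. -/
noncomputable def Sphi {n : ℕ} (c : MixedCoeff n) : Set ℂ :=
  {v | ∃ zk : ℕ → (Fin n → ℂ), (∀ k, zk k ∈ Mphi c) ∧
    Tendsto (fun k => ‖zk k‖) atTop atTop ∧
    Tendsto (fun k => phiMap c (zk k)) atTop (nhds v)}

/-- The asymptotic ρ-non-regular values `S(f)`. -/
noncomputable def Sf {n : ℕ} (c : MixedCoeff n) : Set ℂ :=
  {v | ∃ zk : ℕ → (Fin n → ℂ), (∀ k, zk k ∈ Mf c) ∧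
    Tendsto (fun k => ‖zk k‖) atTop atTop ∧
    Tendsto (fun k => mixedEval c (zk k)) atTop (nhds v)}

/-- `v₁(z) = |f(z)|⁻² (f·conj(df) + conj(f)·d̄f)`, the gradient of `log |f|`. -/
noncomputable def vOne {n : ℕ} (c : MixedCoeff n) (z : Fin n → ℂ) : Fin n → ℂ := fun j =>
  ((‖mixedEval c z‖ : ℂ) ^ 2)⁻¹ *
    (mixedEval c z * (starRingEnd ℂ) (wdz c j z)
      + (starRingEnd ℂ) (mixedEval c z) * wdzbar c j z)

/-- `v₂(z) = i|f(z)|⁻² (f·conj(df) − conj(f)·d̄f)`, the gradient of the argument of `f`. -/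
noncomputable def vTwo {n : ℕ} (c : MixedCoeff n) (z : Fin n → ℂ) : Fin n → ℂ := fun j =>
  Complex.I * ((‖mixedEval c z‖ : ℂ) ^ 2)⁻¹ *
    (mixedEval c z * (starRingEnd ℂ) (wdz c j z)
      - (starRingEnd ℂ) (mixedEval c z) * wdzbar c j z)

/-- The Euclidean inner product `Re⟨a, b⟩ = Re Σ a_j conj(b_j)` on `ℂⁿ ≅ ℝ^{2n}`. -/
noncomputable def hermRe {n : ℕ} (a b : Fin n → ℂ) : ℝ :=
  (∑ j, a j * (starRingEnd ℂ) (b j)).re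

/-- `w / |w| ∈ S¹` (with junk value `1` for `w = 0`). -/
noncomputable def unitArg (w : ℂ) : Metric.sphere (0 : ℂ) 1 :=
  if h : w = 0 then ⟨1, by simp⟩
  else ⟨w / (‖w‖ : ℝ), by
    have h1 : (‖w‖ : ℝ) ≠ 0 := by
      simpa using h
    simp [mem_sphere_iff_norm, norm_div, Complex.norm_real, norm_norm, div_self h1]⟩

/-- A locally trivial fibration with fibre `F`. -/
def IsLocTrivFib {E B F : Type*} [TopologicalSpace E] [TopologicalSpace B]
    [TopologicalSpace F] (p : E → B) : Prop :=
  Continuous p ∧ ∀ b : B, ∃ U : Set B, IsOpen U ∧ b ∈ U ∧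
    ∃ h : (p ⁻¹' U) ≃ₜ U × F, ∀ e : (p ⁻¹' U), ((h e).1 : B) = p (e : E)

/-- Radial weighted homogeneity of type `(q₁,…,q_n; m)`. -/
def RadialWH {n : ℕ} (c : MixedCoeff n) (q : Fin n → ℤ) (m : ℕ) : Prop :=
  Finset.univ.gcd q = 1 ∧ 0 < m ∧
    ∀ p ∈ c.support, ∑ j, q j * (p.1 j + p.2 j : ℤ) = (m : ℤ)

/-- A bad face of `supp̄(f)`. -/
def IsBadFace {n : ℕ} (c : MixedCoeff n) (Δ : Set (Fin n → ℝ)) : Prop :=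
  IsExtreme ℝ (suppBar c) Δ ∧
  ∃ a : Fin n → ℝ, (∃ i, a i < 0) ∧ (∃ j, 0 < a j) ∧
    {x : Fin n → ℝ | ∑ k, a k * x k = 0} ∩ suppBar c = Δ

/-- A strictly bad face of `supp̄(f)`. -/
def IsStrictlyBadFace {n : ℕ} (c : MixedCoeff n) (Δ : Set (Fin n → ℝ)) : Prop :=
  IsBadFace c Δ ∧ (0 : Fin n → ℝ) ∈ affineSpan ℝ Δ

theorem sing_of_vOne_vTwo_dep {n : ℕ} (c : MixedCoeff n) (z : Fin n → ℂ)
    (hz : mixedEval c z ≠ 0)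
    (h : ¬ LinearIndependent ℝ ![vOne c z, vTwo c z]) :
    z ∈ mixedSing c := by
  rw [LinearIndependent.pair_iff] at h
  push Not at h
  obtain ⟨a, b, hab, hne⟩ := h
  have hN : ((‖mixedEval c z‖ : ℂ) ^ 2) ≠ 0 := by simpa using hz
  have hw0 : (a : ℂ) + b * Complex.I ≠ 0 := by
    intro h0
    have h1 := congrArg Complex.re h0
    have h2 := congrArg Complex.im h0
    simp at h1 h2
    exact hne h1 h2
  have hw : ((a : ℂ) + b * Complex.I) * mixedEval c z ≠ 0 := mul_ne_zero hw0 hz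
  refine ⟨-((starRingEnd ℂ) (((a : ℂ) + b * Complex.I) * mixedEval c z)
    / (((a : ℂ) + b * Complex.I) * mixedEval c z)), ?_, ?_⟩
  · rw [norm_neg, norm_div, Complex.norm_conj, div_self (norm_ne_zero_iff.mpr hw)]
  · intro j
    have hj := congrFun hab j
    simp only [Pi.add_apply, Pi.smul_apply, Pi.zero_apply, vOne, vTwo, Complex.real_smul] at hj
    have hj2 : ((‖mixedEval c z‖ : ℂ) ^ 2)⁻¹ *
        (((a : ℂ) + b * Complex.I) * mixedEval c z * (starRingEnd ℂ) (wdz c j z)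
        + ((a : ℂ) - b * Complex.I) * (starRingEnd ℂ) (mixedEval c z) * wdzbar c j z) = 0 := by
      rw [← hj]; ring
    have hj3 := (mul_eq_zero.mp hj2).resolve_left (inv_ne_zero hN)
    have hc : (starRingEnd ℂ) (((a : ℂ) + b * Complex.I) * mixedEval c z)
        = ((a : ℂ) - b * Complex.I) * (starRingEnd ℂ) (mixedEval c z) := by
      simp [sub_eq_add_neg]
    rw [hc]
    apply mul_left_cancel₀ hw
    rw [← mul_assoc, mul_neg, mul_div_cancel₀ _ hw]
    linear_combination hj3
end

section
/- Let f : ℂ² → ℂ be the mixed polynomial f(z₁,z₂) = (1/4)z₁² − (1/4)z̄₁² + z₁z̄₁ − (1+i)(z₁+z₂)(z̄₁+z̄₂). Then Sing f = {(z₁,z₂) ∈ ℂ² : z₁ = 0} ∪ {(z₁,z₂) ∈ ℂ² : z₁ + z₂ = 0 and z₁ − i z̄₁ = 0} ∪ {(z₁,z₂) ∈ ℂ² : z₁ + z₂ = 0 and z₁ + i z̄₁ = 0}. -/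
open Complex Finset Filter Topology

theorem prod_update_pow {n : ℕ} (z : Fin n → ℂ) (j : Fin n) (x : ℂ) (e : Fin n → ℕ) :
    ∏ k, (Function.update z j x k) ^ e k = x ^ e j * ∏ k ∈ Finset.univ.erase j, z k ^ e k := by
  rw [← Finset.mul_prod_erase Finset.univ _ (Finset.mem_univ j)]
  congr 1
  · simp
  · refine Finset.prod_congr rfl fun k hk => ?_
    rw [Function.update_of_ne (Finset.ne_of_mem_erase hk)]

theorem prod_update_conj_pow {n : ℕ} (z : Fin n → ℂ) (j : Fin n) (x : ℂ) (e : Fin n → ℕ) :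
    ∏ k, ((starRingEnd ℂ) (Function.update z j x k)) ^ e k
      = (starRingEnd ℂ) x ^ e j * ∏ k ∈ Finset.univ.erase j, (starRingEnd ℂ) (z k) ^ e k := by
  rw [← Finset.mul_prod_erase Finset.univ _ (Finset.mem_univ j)]
  congr 1
  · simp
  · refine Finset.prod_congr rfl fun k hk => ?_
    rw [Function.update_of_ne (Finset.ne_of_mem_erase hk)]

theorem hasDerivAt_line (a v : ℂ) : HasDerivAt (fun t : ℝ => a + (t : ℂ) * v) v 0 := by
  have h := ((Complex.ofRealCLM.hasDerivAt (x := (0 : ℝ))).mul_const v).const_add a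
  simpa using h

theorem hasDerivAt_mixedEval {n : ℕ} (c : MixedCoeff n) (j : Fin n) (z : Fin n → ℂ) (v : ℂ) :
    HasDerivAt (fun t : ℝ => mixedEval c (Function.update z j (z j + (t : ℂ) * v)))
      (wdz c j z * v + wdzbar c j z * (starRingEnd ℂ) v) 0 := by
  unfold mixedEval wdz wdzbar
  simp only [Finsupp.sum]
  rw [Finset.sum_mul, Finset.sum_mul, ← Finset.sum_add_distrib]
  refine HasDerivAt.fun_sum fun p _ => ?_
  simp only [prod_update_pow, prod_update_conj_pow]
  rw [← Finset.mul_prod_erase Finset.univ (fun k => z k ^ p.1 k) (Finset.mem_univ j),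
    ← Finset.mul_prod_erase Finset.univ (fun k => (starRingEnd ℂ) (z k) ^ p.2 k)
      (Finset.mem_univ j)]
  have h1 := ((hasDerivAt_line (z j) v).pow (p.1 j)).mul_const
    (∏ k ∈ Finset.univ.erase j, z k ^ p.1 k)
  have h2 := ((hasDerivAt_line ((starRingEnd ℂ) (z j)) ((starRingEnd ℂ) v)).pow (p.2 j)).mul_const
    (∏ k ∈ Finset.univ.erase j, (starRingEnd ℂ) (z k) ^ p.2 k)
  have h := (h1.const_mul (c p)).mul h2
  simp only [map_add, map_mul, Complex.conj_ofReal]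
  refine h.congr_deriv ?_
  simp
  ring

theorem wirt_of_eq (A B A' B' : ℂ)
    (h : ∀ v : ℂ, A * v + B * (starRingEnd ℂ) v = A' * v + B' * (starRingEnd ℂ) v) :
    A = A' ∧ B = B' := by
  have h1 := h 1
  have h2 := h Complex.I
  simp only [map_one, mul_one, Complex.conj_I] at h1 h2
  have h3 : A - B = A' - B' := by
    apply mul_right_cancel₀ Complex.I_ne_zero
    linear_combination h2
  constructor
  · linear_combination (h1 + h3) / 2
  · linear_combination (h1 - h3) / 2

theorem oka_wirt0 (c : MixedCoeff 2)
    (hc : ∀ z : Fin 2 → ℂ, mixedEval c z =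
      (1 / 4) * z 0 ^ 2 - (1 / 4) * (starRingEnd ℂ) (z 0) ^ 2
        + z 0 * (starRingEnd ℂ) (z 0)
        - (1 + Complex.I) * (z 0 + z 1) * ((starRingEnd ℂ) (z 0) + (starRingEnd ℂ) (z 1)))
    (z : Fin 2 → ℂ) :
    wdz c 0 z = z 0 / 2 + (starRingEnd ℂ) (z 0)
        - (1 + Complex.I) * ((starRingEnd ℂ) (z 0) + (starRingEnd ℂ) (z 1)) ∧
    wdzbar c 0 z = - (starRingEnd ℂ) (z 0) / 2 + z 0 - (1 + Complex.I) * (z 0 + z 1) := by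
  apply wirt_of_eq
  intro v
  refine (hasDerivAt_mixedEval c 0 z v).unique ?_
  simp only [hc]
  have h1 := hasDerivAt_line (z 0) v
  have h2 := hasDerivAt_line ((starRingEnd ℂ) (z 0)) ((starRingEnd ℂ) v)
  have h := ((((h1.pow 2).const_mul (1 / 4 : ℂ)).sub ((h2.pow 2).const_mul (1 / 4 : ℂ))).add
    (h1.mul h2)).sub (((h1.add_const (z 1)).const_mul (1 + Complex.I)).mul
      (h2.add_const ((starRingEnd ℂ) (z 1))))
  simp only [Function.update_self, ne_eq, one_ne_zero, not_false_eq_true, Function.update_of_ne,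
    map_add, map_mul, Complex.conj_ofReal]
  refine h.congr_deriv ?_
  simp
  ring

theorem oka_wirt1 (c : MixedCoeff 2)
    (hc : ∀ z : Fin 2 → ℂ, mixedEval c z =
      (1 / 4) * z 0 ^ 2 - (1 / 4) * (starRingEnd ℂ) (z 0) ^ 2
        + z 0 * (starRingEnd ℂ) (z 0)
        - (1 + Complex.I) * (z 0 + z 1) * ((starRingEnd ℂ) (z 0) + (starRingEnd ℂ) (z 1)))
    (z : Fin 2 → ℂ) :
    wdz c 1 z = - (1 + Complex.I) * ((starRingEnd ℂ) (z 0) + (starRingEnd ℂ) (z 1)) ∧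
    wdzbar c 1 z = - (1 + Complex.I) * (z 0 + z 1) := by
  apply wirt_of_eq
  intro v
  refine (hasDerivAt_mixedEval c 1 z v).unique ?_
  simp only [hc]
  have h1 := hasDerivAt_line (z 1) v
  have h2 := hasDerivAt_line ((starRingEnd ℂ) (z 1)) ((starRingEnd ℂ) v)
  have h := (((h1.const_add (z 0)).const_mul (1 + Complex.I)).mul
      (h2.const_add ((starRingEnd ℂ) (z 0)))).const_sub ((1 / 4) * z 0 ^ 2
        - (1 / 4) * (starRingEnd ℂ) (z 0) ^ 2 + z 0 * (starRingEnd ℂ) (z 0))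
  simp only [Function.update_self, ne_eq, zero_ne_one, not_false_eq_true, Function.update_of_ne,
    map_add, map_mul, Complex.conj_ofReal]
  refine h.congr_deriv ?_
  simp
  ring

/-- If two complex numbers have the same norm, they differ by a unit factor. -/
theorem exists_unit_mul (a b : ℂ) (h : ‖a‖ = ‖b‖) : ∃ l : ℂ, ‖l‖ = 1 ∧ a = l * b := by
  by_cases hb : b = 0
  · subst hb
    exact ⟨1, by simp, by simpa using h⟩
  · refine ⟨a / b, ?_, by field_simp⟩
    rw [norm_div, h, div_self (by simpa using hb)]

theorem norm_eq_iff_re_sq (a : ℂ) :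
    ‖(starRingEnd ℂ) a / 2 + a‖ = ‖-(starRingEnd ℂ) a / 2 + a‖ ↔ (a.re = a.im ∨ a.re = -a.im) := by
  rw [← sq_eq_sq₀ (norm_nonneg _) (norm_nonneg _), ← Complex.normSq_eq_norm_sq,
    ← Complex.normSq_eq_norm_sq, ← sq_eq_sq_iff_eq_or_eq_neg]
  simp [Complex.normSq_apply]
  constructor <;> intro h <;> linarith

theorem oka_example_sing (c : MixedCoeff 2)
    (hc : ∀ z : Fin 2 → ℂ, mixedEval c z =
      (1 / 4) * z 0 ^ 2 - (1 / 4) * (starRingEnd ℂ) (z 0) ^ 2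
        + z 0 * (starRingEnd ℂ) (z 0)
        - (1 + Complex.I) * (z 0 + z 1) * ((starRingEnd ℂ) (z 0) + (starRingEnd ℂ) (z 1))) :
    mixedSing c =
      {z : Fin 2 → ℂ | z 0 = 0} ∪
        {z : Fin 2 → ℂ | z 0 + z 1 = 0 ∧ z 0 - Complex.I * (starRingEnd ℂ) (z 0) = 0} ∪
        {z : Fin 2 → ℂ | z 0 + z 1 = 0 ∧ z 0 + Complex.I * (starRingEnd ℂ) (z 0) = 0} := by
  ext z
  obtain ⟨e1, e2⟩ := oka_wirt0 c hc z
  obtain ⟨e3, e4⟩ := oka_wirt1 c hc z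
  have hI : Complex.I * Complex.I = -1 := Complex.I_mul_I
  simp only [mixedSing, Set.mem_setOf_eq, Set.mem_union, Fin.forall_fin_two, e1, e2, e3, e4,
    map_sub, map_add, map_mul, map_neg, map_div₀, map_one, Complex.conj_I, Complex.conj_conj]
  have h2 : (starRingEnd ℂ) (2 : ℂ) = 2 := Complex.conj_ofNat 2
  rw [h2]
  have key1 : z 0 - Complex.I * (starRingEnd ℂ) (z 0) = 0 ↔ (z 0).re = (z 0).im := by
    rw [Complex.ext_iff]
    simp
    constructor
    · intro h; linarith [h.1]
    · intro h; constructor <;> linarith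
  have key2 : z 0 + Complex.I * (starRingEnd ℂ) (z 0) = 0 ↔ (z 0).re = -(z 0).im := by
    rw [Complex.ext_iff]
    simp
    constructor
    · intro h; linarith [h.1]
    · intro h; constructor <;> linarith
  rw [key1, key2]
  constructor
  · rintro ⟨l, hl, ha, hb⟩
    by_cases hw : z 0 + z 1 = 0
    · rw [hw] at ha
      have : ‖(starRingEnd ℂ) (z 0) / 2 + z 0‖ = ‖-(starRingEnd ℂ) (z 0) / 2 + z 0‖ := by
        have h3 : (starRingEnd ℂ) (z 0) / 2 + z 0 = l * (-(starRingEnd ℂ) (z 0) / 2 + z 0) := by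
          linear_combination ha
        rw [h3, norm_mul, hl, one_mul]
      rcases (norm_eq_iff_re_sq _).1 this with h | h
      · exact Or.inl (Or.inr ⟨hw, h⟩)
      · exact Or.inr ⟨hw, h⟩
    · left; left
      have h5 : (1 - Complex.I) = l * (1 + Complex.I) := by
        apply mul_right_cancel₀ hw
        linear_combination -hb
      have hl' : l = -Complex.I := by
        linear_combination (-(1 - Complex.I) / 2) * h5 + (1 / 2 + l / 2) * hI
      subst hl'
      have h6 : (starRingEnd ℂ) (z 0) / 2 + z 0
          = -Complex.I * (-(starRingEnd ℂ) (z 0) / 2 + z 0) := by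
        linear_combination ha - hb
      have h7 := congrArg Complex.re h6
      have h8 := congrArg Complex.im h6
      simp at h7 h8
      apply Complex.ext
      · simp; linarith
      · simp; linarith
  · have hcase : (z 0 + z 1 = 0 ∧ ((z 0).re = (z 0).im ∨ (z 0).re = -(z 0).im)) →
        ∃ lam : ℂ, ‖lam‖ = 1 ∧
        (starRingEnd ℂ) (z 0) / 2 + z 0 - (1 + -Complex.I) * (z 0 + z 1) =
          lam * (-(starRingEnd ℂ) (z 0) / 2 + z 0 - (1 + Complex.I) * (z 0 + z 1)) ∧
        -(1 + -Complex.I) * (z 0 + z 1) = lam * (-(1 + Complex.I) * (z 0 + z 1)) := by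
      rintro ⟨hw, h⟩
      obtain ⟨l, hl, h3⟩ := exists_unit_mul _ _ ((norm_eq_iff_re_sq _).2 h)
      refine ⟨l, hl, ?_, ?_⟩
      · rw [hw]; linear_combination h3
      · rw [hw]; ring
    rintro ((h | h) | h)
    · refine ⟨-Complex.I, by simp, ?_, ?_⟩
      · rw [h]; simp; linear_combination (-z 1) * hI
      · linear_combination (-(z 0 + z 1)) * hI
    · exact hcase ⟨h.1, Or.inl h.2⟩
    · exact hcase ⟨h.1, Or.inr h.2⟩
end
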